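/- arXiv:1809.09276 — 6 statements merged into one kernel-verified Lean document; each statement's English description precedes it below -/
import Mathlib

section
/- Let α, q ∈ (0,1). Then for every s ∈ [0,1]: ∑_{x=1}^{∞} (Γ(α+1) sin(πα) / (π (1-(1-q)^α))) · (Γ(x-α)/x!) · (qs)^x = (1-(1-sq)^α) / (1-(1-q)^α). In particular (taking s = 1), the zero-truncated extended negative binomial weights sum to 1, so ENB(α,q) is a probability distribution on the positive integers. -/
open Real
open scoped BigOperators

/-- The zero-truncated extended negative binomial probability mass at `x ≥ 1`. -/
noncomputable def enbPMF (α q : ℝ) (x : ℕ) : ℝ :=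
  Real.Gamma (α + 1) * Real.sin (π * α) / (π * (1 - (1 - q) ^ α)) *
    (Real.Gamma ((x : ℝ) - α) / (Nat.factorial x : ℝ)) * q ^ x

/-- The Gamma function shifts by the rising factorial. -/
theorem gamma_add_nat_eq_mul_multichoose {a : ℝ} (ha : ∀ m : ℕ, a ≠ -m) (n : ℕ) :
    Real.Gamma (a + n) = Real.Gamma a * (n.factorial * Ring.multichoose a n) := by
  rw [← nsmul_eq_mul, Ring.factorial_nsmul_multichoose_eq_ascPochhammer,
    Polynomial.ascPochhammer_smeval_eq_eval]
  induction n with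
  | zero => simp
  | succ n ih =>
    have h : a + n ≠ 0 := fun h => ha n (by linarith)
    rw [Nat.cast_succ, ← add_assoc, Real.Gamma_add_one h, ih, ascPochhammer_succ_eval]
    ring

/-- The reflection formula, in the form giving the normalizing constant. -/
theorem gamma_add_one_mul_sin_mul_gamma_neg {α : ℝ} (hα : ∀ n : ℤ, α ≠ n) :
    Real.Gamma (α + 1) * Real.sin (π * α) * Real.Gamma (-α) = -π := by
  have hsin : Real.sin (π * α) ≠ 0 := by
    rw [Real.sin_ne_zero_iff]
    intro n h
    rw [mul_comm] at h
    exact hα n (mul_left_cancel₀ Real.pi_ne_zero h.symm)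
  have h := Real.Gamma_mul_Gamma_one_sub (α + 1)
  rw [show 1 - (α + 1) = -α by ring, mul_add, mul_one, Real.sin_add_pi] at h
  rw [mul_right_comm, h, div_neg, neg_mul, div_mul_cancel₀ _ hsin]

/-- The binomial series of `(1 - x) ^ α`. -/
theorem hasSum_multichoose_neg_mul_pow (α : ℝ) {x : ℝ} (hx : |x| < 1) :
    HasSum (fun n : ℕ => Ring.multichoose (-α) n * x ^ n) ((1 - x) ^ α) := by
  have h := (Real.one_div_one_sub_rpow_hasFPowerSeriesOnBall_zero (-α)).hasSum (y := x)
    (by rw [← ENNReal.ofReal_one, Metric.eball_ofReal]; simpa using hx)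
  have hpos : 0 ≤ 1 - x := by linarith [(abs_lt.mp hx).2]
  simpa [Real.rpow_neg hpos, Ring.multichoose_eq, mul_comm] using h

/-- The generating function of the positive-index weights. -/
theorem hasSum_enb_weights {α q x : ℝ} (hα : α ∈ Set.Ioo (0 : ℝ) 1) (hx : |x| < 1) :
    HasSum (fun n : ℕ => Real.Gamma (α + 1) * Real.sin (π * α) / (π * (1 - (1 - q) ^ α)) *
        (Real.Gamma (((n + 1 : ℕ) : ℝ) - α) / (Nat.factorial (n + 1) : ℝ)) * x ^ (n + 1))
      ((1 - (1 - x) ^ α) / (1 - (1 - q) ^ α)) := by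
  have hint : ∀ n : ℤ, α ≠ n := by
    rintro n rfl
    have h0 : 0 < n := by exact_mod_cast hα.1
    have h1 : n < 1 := by exact_mod_cast hα.2
    omega
  have hneg : ∀ m : ℕ, -α ≠ -m := fun m h => hint m (by simpa using h)
  have h := (hasSum_nat_add_iff' 1).mpr (hasSum_multichoose_neg_mul_pow α hx)
  simp only [Finset.sum_range_one, Ring.multichoose_zero_right, pow_zero, mul_one] at h
  convert! h.mul_left (-(1 - (1 - q) ^ α)⁻¹) using 1
  · funext n
    have hf : ((n + 1).factorial : ℝ) ≠ 0 := by positivity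
    rw [show ((n + 1 : ℕ) : ℝ) - α = -α + (n + 1 : ℕ) by ring,
      gamma_add_nat_eq_mul_multichoose hneg, mul_left_comm, mul_div_cancel_left₀ _ hf,
      mul_comm π (1 - _), ← div_div, div_right_comm, div_eq_mul_inv _ (1 - (1 - q) ^ α)]
    linear_combination (π⁻¹ * (1 - (1 - q) ^ α)⁻¹ * Ring.multichoose (-α) (n + 1) * x ^ (n + 1)) *
      gamma_add_one_mul_sin_mul_gamma_neg hint -
      ((1 - (1 - q) ^ α)⁻¹ * Ring.multichoose (-α) (n + 1) * x ^ (n + 1)) *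
        inv_mul_cancel₀ Real.pi_ne_zero
  · ring

/-- The probability generating function of `ENB(α,q)`, and the fact that the weights
sum to `1`.  The series `∑_{x=1}^∞` is encoded as a `tsum` over `x : ℕ` of the term
of index `x+1`. -/
theorem stmt2 (α q : ℝ) (hα : α ∈ Set.Ioo (0 : ℝ) 1) (hq : q ∈ Set.Ioo (0 : ℝ) 1) :
    (∀ s ∈ Set.Icc (0 : ℝ) 1,
      ∑' x : ℕ, (Real.Gamma (α + 1) * Real.sin (π * α) / (π * (1 - (1 - q) ^ α)) *
          (Real.Gamma (((x + 1 : ℕ) : ℝ) - α) / (Nat.factorial (x + 1) : ℝ)) *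
          (q * s) ^ (x + 1)) =
        (1 - (1 - s * q) ^ α) / (1 - (1 - q) ^ α)) ∧
    ∑' x : ℕ, enbPMF α q (x + 1) = 1 := by
  have hsum : ∀ s ∈ Set.Icc (0 : ℝ) 1, |q * s| < 1 := by
    rintro s ⟨hs0, hs1⟩
    rw [abs_of_nonneg (mul_nonneg hq.1.le hs0)]
    nlinarith [hq.1, hq.2]
  refine ⟨fun s hs => ?_, ?_⟩
  · rw [mul_comm s q]
    exact (hasSum_enb_weights hα (hsum s hs)).tsum_eq
  · have hlt : (1 - q) ^ α < 1 :=
      Real.rpow_lt_one (by linarith [hq.2]) (by linarith [hq.1]) hα.1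
    have h := (hasSum_enb_weights (q := q) hα (by simpa using hsum 1 (by simp))).tsum_eq
    rwa [div_self (by linarith)] at h
end

section
/- Fix α ∈ (0,1) and z > 0. Then for every integer k ≥ 1: lim_{n→∞} 𝒞(n,k;α) z^k / ∑_{j=1}^{n} 𝒞(n,j;α) z^j = e^{-z} z^{k-1} / (k-1)!. In other words, the probability distribution ρ({k}; α,n,z) := 𝒞(n,k;α) z^k / ∑_{j=1}^{n} 𝒞(n,j;α) z^j on {1,…,n} converges pointwise, as n → ∞, to the distribution of 1 + N_z, where N_z is Poisson with mean z. -/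
open Real Filter
open scoped BigOperators Topology

/-- Rising factorial `[x]_{(n,a)} = ∏_{i=0}^{n-1} (x + i a)`. -/
noncomputable def risingFac (x : ℝ) (n : ℕ) (a : ℝ) : ℝ :=
  ∏ i ∈ Finset.range n, (x + i * a)

/-- Generalized factorial coefficient
`𝒞(n,k;α) = (1/k!) ∑_{i=1}^{k} (-1)^i C(k,i) [-iα]_{(n,1)}`. -/
noncomputable def genFacCoeff (n k : ℕ) (α : ℝ) : ℝ :=
  (1 / (Nat.factorial k : ℝ)) *
    ∑ i ∈ Finset.Icc 1 k, (-1 : ℝ) ^ i * (Nat.choose k i : ℝ) * risingFac (-(i : ℝ) * α) n 1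

/-- The generalized factorial coefficient with the `i = 0` term included in the sum. It agrees with
`genFacCoeff` for `n ≥ 1` and satisfies the triangular recurrence from `n = 0` on. -/
noncomputable def fullFacCoeff (n k : ℕ) (α : ℝ) : ℝ :=
  (1 / (Nat.factorial k : ℝ)) *
    ∑ i ∈ Finset.range (k + 1),
      (-1 : ℝ) ^ i * (Nat.choose k i : ℝ) * risingFac (-(i : ℝ) * α) n 1

lemma risingFac_succ (x : ℝ) (n : ℕ) (a : ℝ) :
    risingFac x (n + 1) a = risingFac x n a * (x + n * a) :=
  Finset.prod_range_succ _ _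

lemma risingFac_zero_left (n : ℕ) (a : ℝ) : risingFac 0 (n + 1) a = 0 :=
  Finset.prod_eq_zero (Finset.mem_range.2 n.succ_pos) (by simp)

lemma genFacCoeff_succ_eq_fullFacCoeff (n k : ℕ) (α : ℝ) :
    genFacCoeff (n + 1) k α = fullFacCoeff (n + 1) k α := by
  unfold genFacCoeff fullFacCoeff
  rw [Finset.range_eq_Ico, Finset.sum_eq_sum_Ico_succ_bot (Nat.succ_pos k)]
  simp only [Nat.cast_zero, neg_zero, zero_mul, risingFac_zero_left, mul_zero, zero_add]
  rfl

lemma fullFacCoeff_zero_left (k : ℕ) (α : ℝ) :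
    fullFacCoeff 0 k α = if k = 0 then 1 else 0 := by
  have h := congrArg (Int.cast : ℤ → ℝ) (Int.alternating_sum_range_choose (n := k))
  push_cast at h
  simp only [fullFacCoeff, risingFac, Finset.range_zero, Finset.prod_empty, mul_one, h]
  split_ifs with hk <;> simp [hk]

lemma fullFacCoeff_succ_zero (n : ℕ) (α : ℝ) : fullFacCoeff (n + 1) 0 α = 0 := by
  simp [fullFacCoeff, risingFac_zero_left]

lemma fullFacCoeff_succ_succ (n k : ℕ) (α : ℝ) :
    fullFacCoeff (n + 1) (k + 1) α =
      (n - (k + 1) * α) * fullFacCoeff n (k + 1) α + α * fullFacCoeff n k α := by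
  have key : ∑ i ∈ Finset.range (k + 2), (-1 : ℝ) ^ i * (Nat.choose (k + 1) i : ℝ) *
        risingFac (-(i : ℝ) * α) (n + 1) 1 =
      (n - (k + 1) * α) * ∑ i ∈ Finset.range (k + 2), (-1 : ℝ) ^ i *
        (Nat.choose (k + 1) i : ℝ) * risingFac (-(i : ℝ) * α) n 1 +
      (k + 1) * α * ∑ i ∈ Finset.range (k + 1), (-1 : ℝ) ^ i *
        (Nat.choose k i : ℝ) * risingFac (-(i : ℝ) * α) n 1 := by
    have hext : ∑ i ∈ Finset.range (k + 1), (-1 : ℝ) ^ i *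
        (Nat.choose k i : ℝ) * risingFac (-(i : ℝ) * α) n 1 =
        ∑ i ∈ Finset.range (k + 2), (-1 : ℝ) ^ i *
        (Nat.choose k i : ℝ) * risingFac (-(i : ℝ) * α) n 1 := by
      rw [Finset.sum_range_succ _ (k + 1)]
      simp
    rw [hext, Finset.mul_sum, Finset.mul_sum, ← Finset.sum_add_distrib]
    refine Finset.sum_congr rfl fun i hi => ?_
    have hik : i ≤ k + 1 := Nat.lt_succ_iff.1 (Finset.mem_range.1 hi)
    have hchoose : ((k : ℝ) + 1) * (Nat.choose k i : ℝ) =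
        (Nat.choose (k + 1) i : ℝ) * ((k : ℝ) + 1 - i) := by
      have h := congrArg (Nat.cast : ℕ → ℝ) (Nat.choose_mul_succ_eq k i)
      push_cast [Nat.cast_sub hik] at h
      linarith
    rw [risingFac_succ]
    linear_combination (-(-1 : ℝ) ^ i * risingFac (-(i : ℝ) * α) n 1 * α) * hchoose
  unfold fullFacCoeff
  rw [key, Nat.factorial_succ]
  push_cast
  field_simp

lemma fullFacCoeff_eq_zero_of_lt (α : ℝ) : ∀ {n k : ℕ}, n < k → fullFacCoeff n k α = 0
  | 0, k, h => by simp [fullFacCoeff_zero_left, h.ne']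
  | n + 1, k + 1, h => by
    rw [fullFacCoeff_succ_succ, fullFacCoeff_eq_zero_of_lt α (by omega : n < k + 1),
      fullFacCoeff_eq_zero_of_lt α (by omega : n < k)]
    ring

lemma fullFacCoeff_nonneg {α : ℝ} (hα : α ∈ Set.Ioo (0 : ℝ) 1) :
    ∀ n k : ℕ, 0 ≤ fullFacCoeff n k α
  | 0, k => by rw [fullFacCoeff_zero_left]; split_ifs <;> norm_num
  | n + 1, 0 => (fullFacCoeff_succ_zero n α).ge
  | n + 1, k + 1 => by
    rw [fullFacCoeff_succ_succ]
    refine add_nonneg ?_ (mul_nonneg hα.1.le (fullFacCoeff_nonneg hα n k))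
    rcases lt_or_ge n (k + 1) with h | h
    · simp [fullFacCoeff_eq_zero_of_lt α h]
    · have h' : ((k : ℝ) + 1) ≤ n := by exact_mod_cast h
      refine mul_nonneg ?_ (fullFacCoeff_nonneg hα n (k + 1))
      nlinarith [hα.1, hα.2]

lemma fullFacCoeff_one_right (n : ℕ) (α : ℝ) :
    fullFacCoeff (n + 1) 1 α = -risingFac (-α) (n + 1) 1 := by
  simp [fullFacCoeff, Finset.sum_range_succ, risingFac_zero_left]

lemma fullFacCoeff_one_right_pos {α : ℝ} (hα : α ∈ Set.Ioo (0 : ℝ) 1) (n : ℕ) :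
    0 < fullFacCoeff (n + 1) 1 α := by
  induction n with
  | zero => simpa [fullFacCoeff_one_right, risingFac] using hα.1
  | succ n ih =>
    rw [fullFacCoeff_succ_succ, fullFacCoeff_succ_zero]
    have : (0 : ℝ) ≤ n := n.cast_nonneg
    have : 0 < ((n + 1 : ℕ) : ℝ) - ((0 : ℕ) + 1) * α := by push_cast; linarith [hα.2]
    nlinarith [mul_pos this ih]

lemma fullFacCoeff_le {α : ℝ} (hα : α ∈ Set.Ioo (0 : ℝ) 1) (n k : ℕ) :
    fullFacCoeff (n + 1) (k + 1) α ≤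
      fullFacCoeff (n + 1) 1 α * ((1 - α)⁻¹ ^ k / Nat.factorial k) := by
  have hα' : 0 < 1 - α := sub_pos.2 hα.2
  induction n generalizing k with
  | zero =>
    rcases k with _ | k
    · simp
    · rw [fullFacCoeff_eq_zero_of_lt α (by omega)]
      exact mul_nonneg (fullFacCoeff_nonneg hα _ _) (by positivity)
  | succ n ih =>
    rcases k with _ | k
    · simp
    have hpos := fullFacCoeff_nonneg hα (n + 1) 1
    have hb : (1 - α)⁻¹ ^ k / (Nat.factorial k : ℝ) =
        (k + 1) * (1 - α) * ((1 - α)⁻¹ ^ (k + 1) / (Nat.factorial (k + 1) : ℝ)) := by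
      rw [Nat.factorial_succ, pow_succ]
      push_cast
      field_simp
    have hk0 := ih k
    have hk1 := ih (k + 1)
    rw [hb] at hk0
    have hbpos : 0 ≤ (1 - α)⁻¹ ^ (k + 1) / (Nat.factorial (k + 1) : ℝ) := by positivity
    set b := (1 - α)⁻¹ ^ (k + 1) / (Nat.factorial (k + 1) : ℝ)
    have h0 := mul_le_mul_of_nonneg_left hk0 hα.1.le
    have hn : (0 : ℝ) ≤ n := n.cast_nonneg
    have hk : (0 : ℝ) ≤ k := k.cast_nonneg
    have hxb := mul_nonneg hpos hbpos
    rw [fullFacCoeff_succ_succ, fullFacCoeff_succ_succ (n + 1) 0, fullFacCoeff_succ_zero]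
    rcases lt_trichotomy (n + 1) (k + 1) with h | h | h
    · rw [fullFacCoeff_eq_zero_of_lt α h, fullFacCoeff_eq_zero_of_lt α (by omega : n + 1 < k + 1 + 1)]
      have : 0 ≤ ((n + 1 : ℕ) : ℝ) - ((0 : ℕ) + 1) * α := by push_cast; linarith
      simp only [mul_zero, add_zero]
      exact mul_nonneg (mul_nonneg this hpos) hbpos
    · obtain rfl : n = k := by omega
      rw [fullFacCoeff_eq_zero_of_lt α (by omega : n + 1 < n + 1 + 1), mul_zero, zero_add]
      refine h0.trans ?_
      push_cast
      have : 0 ≤ (n + 1 : ℝ) - α - α * ((n + 1) * (1 - α)) := by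
        nlinarith [sq_nonneg (1 - α), mul_nonneg hn (sq_nonneg (1 - α)), mul_nonneg hn hα.1.le]
      nlinarith [mul_nonneg this hxb]
    · have hnk : (k : ℝ) + 2 ≤ n + 1 := by exact_mod_cast (by omega : k + 2 ≤ n + 1)
      have hc : 0 ≤ ((n + 1 : ℕ) : ℝ) - ((k + 1 : ℕ) + 1) * α := by
        push_cast; nlinarith [hα.1, hα.2]
      refine (add_le_add (mul_le_mul_of_nonneg_left hk1 hc) h0).trans ?_
      push_cast
      have : 0 ≤ α ^ 2 * (k + 1) := by positivity
      nlinarith [mul_nonneg this hxb]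

lemma tendsto_risingFac_div {α : ℝ} (hα : α ∈ Set.Ioo (0 : ℝ) 1) {i : ℕ} (hi : 2 ≤ i) :
    Tendsto (fun n : ℕ => risingFac (-(i : ℝ) * α) n 1 / risingFac (-α) n 1) atTop (𝓝 0) := by
  set q : ℕ → ℝ := fun n => risingFac (-(i : ℝ) * α) n 1 / risingFac (-α) n 1 with hq
  set S : ℕ → ℝ := fun n => ∑ m ∈ Finset.range n, 1 / ((m : ℝ) + 1) with hS
  have hS_top : Tendsto S atTop atTop := Real.tendsto_sum_range_one_div_nat_succ_atTop
  set c : ℝ := (i - 1) * α with hc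
  have hi' : (2 : ℝ) ≤ i := by exact_mod_cast hi
  have hc0 : 0 < c := mul_pos (by linarith) hα.1
  obtain ⟨N, hN⟩ := exists_nat_ge (i * α + 1)
  have hstep : ∀ n, N ≤ n → |q (n + 1)| ≤ |q n| * Real.exp (-c * (1 / (n + 1))) := by
    intro n hn
    have hn' : i * α + 1 ≤ (n : ℝ) := hN.trans (by exact_mod_cast hn)
    have hiα : α ≤ i * α := by nlinarith [hα.1]
    have hden : 0 < (n : ℝ) - α := by linarith
    have heq : q (n + 1) = q n * (((n : ℝ) - i * α) / (n - α)) := by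
      simp only [hq, risingFac_succ]
      rw [mul_div_mul_comm]
      congr 2 <;> ring
    have hfac : ((n : ℝ) - i * α) / (n - α) = -(c / (n - α)) + 1 := by
      rw [hc]; field_simp; ring
    have hfac0 : 0 ≤ ((n : ℝ) - i * α) / (n - α) := div_nonneg (by linarith) hden.le
    rw [heq, abs_mul, abs_of_nonneg hfac0]
    refine mul_le_mul_of_nonneg_left ?_ (abs_nonneg _)
    rw [hfac]
    refine le_trans ?_ (Real.add_one_le_exp _)
    have : c * (1 / (n + 1)) ≤ c / (n - α) := by
      rw [mul_one_div]
      exact div_le_div_of_nonneg_left hc0.le hden (by linarith [hα.1])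
    linarith
  have hbound : ∀ n, N ≤ n → |q n| ≤ |q N| * Real.exp (c * S N) * Real.exp (-c * S n) := by
    intro n hn
    induction n, hn using Nat.le_induction with
    | base => rw [mul_assoc, ← Real.exp_add]; simp
    | succ n hn ih =>
      refine (hstep n hn).trans ((mul_le_mul_of_nonneg_right ih (Real.exp_pos _).le).trans_eq ?_)
      rw [mul_assoc, ← Real.exp_add]
      simp only [hS, Finset.sum_range_succ, mul_add]
  have hexp : Tendsto (fun n => |q N| * Real.exp (c * S N) * Real.exp (-c * S n)) atTop (𝓝 0) := by
    rw [← mul_zero (|q N| * Real.exp (c * S N))]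
    exact (Real.tendsto_exp_atBot.comp
      (hS_top.const_mul_atTop_of_neg (neg_lt_zero.2 hc0))).const_mul _
  exact squeeze_zero_norm' (eventually_atTop.2 ⟨N, hbound⟩) hexp

lemma tendsto_fullFacCoeff_div {α : ℝ} (hα : α ∈ Set.Ioo (0 : ℝ) 1) (k : ℕ) :
    Tendsto (fun n : ℕ => fullFacCoeff (n + 1) (k + 1) α / fullFacCoeff (n + 1) 1 α) atTop
      (𝓝 (1 / (Nat.factorial k : ℝ))) := by
  have hterm : ∀ i ∈ Finset.range (k + 2), Tendsto (fun n : ℕ =>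
      (-1 : ℝ) ^ i * (Nat.choose (k + 1) i : ℝ) *
        (risingFac (-(i : ℝ) * α) (n + 1) 1 / risingFac (-α) (n + 1) 1)) atTop
      (𝓝 (if i = 1 then -((k : ℝ) + 1) else 0)) := by
    intro i _
    rcases (by omega : i = 0 ∨ i = 1 ∨ 2 ≤ i) with rfl | rfl | hi
    · simp [risingFac_zero_left]
    · refine tendsto_const_nhds.congr fun n => ?_
      have h := fullFacCoeff_one_right_pos hα n
      rw [fullFacCoeff_one_right] at h
      have h' : risingFac (-α) (n + 1) 1 ≠ 0 := (neg_pos.1 h).ne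
      simp [div_self h']
    · rw [if_neg (by omega)]
      simpa using ((tendsto_risingFac_div hα hi).comp (tendsto_add_atTop_nat 1)).const_mul
        ((-1 : ℝ) ^ i * (Nat.choose (k + 1) i : ℝ))
  have hsum := (tendsto_finsetSum _ hterm).const_mul (-(1 / (Nat.factorial (k + 1) : ℝ)))
  rw [Finset.sum_ite_eq' _ 1, if_pos (by simp)] at hsum
  convert hsum using 2 with n
  · rw [fullFacCoeff_one_right, fullFacCoeff, div_neg, mul_div_assoc, Finset.sum_div, neg_mul]
    simp only [mul_div_assoc]
  · rw [Nat.factorial_succ]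
    push_cast
    field_simp

lemma tendsto_sum_fullFacCoeff_div {α : ℝ} (hα : α ∈ Set.Ioo (0 : ℝ) 1) {z : ℝ} (hz : 0 < z) :
    Tendsto (fun n : ℕ => ∑ j ∈ Finset.Icc 1 (n + 1),
        fullFacCoeff (n + 1) j α / fullFacCoeff (n + 1) 1 α * z ^ j) atTop
      (𝓝 (z * Real.exp z)) := by
  have hα' : 0 < 1 - α := sub_pos.2 hα.2
  have hlim := tendsto_tsum_of_dominated_convergence (𝓕 := atTop)
    (f := fun n j : ℕ => fullFacCoeff (n + 1) (j + 1) α / fullFacCoeff (n + 1) 1 α * z ^ (j + 1))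
    (g := fun j : ℕ => 1 / (Nat.factorial j : ℝ) * z ^ (j + 1))
    (bound := fun j : ℕ => z * (((1 - α)⁻¹ * z) ^ j / (Nat.factorial j : ℝ)))
    ((Real.summable_pow_div_factorial _).mul_left z)
    (fun j => (tendsto_fullFacCoeff_div hα j).mul_const _)
    (Eventually.of_forall fun n j => by
      have h1 := fullFacCoeff_one_right_pos hα n
      have h2 := fullFacCoeff_nonneg hα (n + 1) (j + 1)
      rw [Real.norm_of_nonneg (by positivity)]
      have h3 := (div_le_iff₀' h1).2 (fullFacCoeff_le hα n j)
      refine (mul_le_mul_of_nonneg_right h3 (by positivity)).trans_eq ?_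
      rw [mul_pow, pow_succ z]
      ring)
  convert hlim using 2 with n
  · rw [tsum_eq_sum (s := Finset.range (n + 1)), Finset.range_eq_Ico,
      Finset.sum_Ico_add' (fun j => fullFacCoeff (n + 1) j α / fullFacCoeff (n + 1) 1 α * z ^ j)]
    · rfl
    · intro j hj
      rw [fullFacCoeff_eq_zero_of_lt α (by simpa using hj)]
      simp
  · rw [Real.exp_eq_exp_ℝ, NormedSpace.exp_eq_tsum_div, ← tsum_mul_left]
    refine tsum_congr fun j => ?_
    ring

theorem stmt4 (α z : ℝ) (hα : α ∈ Set.Ioo (0 : ℝ) 1) (hz : 0 < z) (k : ℕ) (hk : 1 ≤ k) :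
    Tendsto (fun n : ℕ =>
        genFacCoeff n k α * z ^ k / ∑ j ∈ Finset.Icc 1 n, genFacCoeff n j α * z ^ j)
      atTop (𝓝 (Real.exp (-z) * z ^ (k - 1) / (Nat.factorial (k - 1) : ℝ))) := by
  obtain ⟨k, rfl⟩ : ∃ m, k = m + 1 := ⟨k - 1, by omega⟩
  rw [← tendsto_add_atTop_iff_nat 1]
  have hlim := ((tendsto_fullFacCoeff_div hα k).mul_const (z ^ (k + 1))).div
    (tendsto_sum_fullFacCoeff_div hα hz) (by positivity)
  convert hlim using 2 with n
  · have h := (fullFacCoeff_one_right_pos hα n).ne'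
    simp only [genFacCoeff_succ_eq_fullFacCoeff, Pi.div_apply, div_mul_eq_mul_div,
      ← Finset.sum_div]
    rw [div_div_div_cancel_right₀ h]
  · rw [Real.exp_neg, Nat.add_sub_cancel, pow_succ]
    field_simp
end

section
/- For every α ∈ (0,1), every integer n ≥ 1 and every real z > 0: ∑_{k=1}^{n} 𝒞(n,k;α) z^k = ∑_{i=1}^{n} (-1)^i [-iα]_{(n,1)} e^{z} z^i Γ(n-i+1, z) / (i! · (n-i)!), where Γ(a,x) := ∫_x^∞ t^{a-1} e^{-t} dt is the upper incomplete gamma function (so Γ(n-i+1) = (n-i)!). -/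
open Real
open scoped BigOperators

/-- Upper incomplete gamma function `Γ(a,x) = ∫_x^∞ t^{a-1} e^{-t} dt`. -/
noncomputable def upperGamma (a x : ℝ) : ℝ :=
  ∫ t in Set.Ioi x, t ^ (a - 1) * Real.exp (-t)

theorem hasDerivAt_neg_exp_neg_mul_sum (m : ℕ) (t : ℝ) :
    HasDerivAt (fun t : ℝ => -(Real.exp (-t) * ∑ j ∈ Finset.range (m + 1), t ^ j / (j.factorial : ℝ)))
      (t ^ m / (m.factorial : ℝ) * Real.exp (-t)) t := by
  have hexp : HasDerivAt (fun t : ℝ => Real.exp (-t)) (-Real.exp (-t)) t := by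
    simpa using (hasDerivAt_neg t).exp
  induction m with
  | zero =>
    simp only [zero_add, Finset.sum_range_one, pow_zero, Nat.factorial_zero, Nat.cast_one, div_one,
      mul_one, one_mul]
    exact hexp.fun_neg.congr_deriv (neg_neg _)
  | succ m ih =>
    have hterm := ((hasDerivAt_pow (m + 1) t).div_const ((m + 1).factorial : ℝ))
    simp only [Finset.sum_range_succ _ (m + 1), mul_add, neg_add, ← sub_eq_add_neg]
    refine (ih.fun_sub (hexp.fun_mul hterm)).congr_deriv ?_
    rw [Nat.factorial_succ]
    push_cast
    have h1 : (m.factorial : ℝ) ≠ 0 := by positivity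
    have h2 : (m : ℝ) + 1 ≠ 0 := by positivity
    field_simp
    ring

theorem tendsto_neg_exp_neg_mul_sum (m : ℕ) :
    Filter.Tendsto
      (fun t : ℝ => -(Real.exp (-t) * ∑ j ∈ Finset.range (m + 1), t ^ j / (j.factorial : ℝ)))
      Filter.atTop (nhds 0) := by
  have h : Filter.Tendsto
      (fun t : ℝ => ∑ j ∈ Finset.range (m + 1), t ^ j * Real.exp (-t) / (j.factorial : ℝ))
      Filter.atTop (nhds (∑ j ∈ Finset.range (m + 1), 0 / (j.factorial : ℝ))) :=
    tendsto_finsetSum _ fun j _ =>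
      (Real.tendsto_pow_mul_exp_neg_atTop_nhds_zero j).div_const _
  convert h.neg using 1
  · funext t
    rw [Finset.mul_sum]
    congr 1
    exact Finset.sum_congr rfl fun j _ => by ring
  · simp

/-- `Γ(m+1, z) = m! e^{-z} ∑_{j=0}^{m} z^j / j!`. -/
theorem upperGamma_natCast_add_one (m : ℕ) {z : ℝ} (hz : 0 < z) :
    upperGamma ((m : ℝ) + 1) z =
      (m.factorial : ℝ) *
        (Real.exp (-z) * ∑ j ∈ Finset.range (m + 1), z ^ j / (j.factorial : ℝ)) := by
  have h := MeasureTheory.integral_Ioi_of_hasDerivAt_of_nonneg'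
    (fun t _ => hasDerivAt_neg_exp_neg_mul_sum m t)
    (fun t (ht : z < t) => by have := hz.trans ht; positivity)
    (tendsto_neg_exp_neg_mul_sum m)
  rw [zero_sub, neg_neg] at h
  rw [← h, ← MeasureTheory.integral_const_mul, upperGamma]
  congr 1
  funext t
  rw [add_sub_cancel_right, Real.rpow_natCast]
  have : (m.factorial : ℝ) ≠ 0 := by positivity
  field_simp

theorem exp_mul_upperGamma_sub_add_one {n i : ℕ} (hi : i ≤ n) {z : ℝ} (hz : 0 < z) :
    Real.exp z * z ^ i * upperGamma ((n : ℝ) - i + 1) z / ((n - i).factorial : ℝ) =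
      ∑ k ∈ Finset.Icc i n, z ^ k / ((k - i).factorial : ℝ) := by
  have hne : ((n - i).factorial : ℝ) ≠ 0 := by positivity
  rw [← Nat.cast_sub hi, upperGamma_natCast_add_one _ hz, ← Finset.Ico_add_one_right_eq_Icc,
    Finset.sum_Ico_eq_sum_range, Real.exp_neg, Nat.sub_add_comm hi]
  have hexp := Real.exp_ne_zero z
  field_simp
  rw [Finset.mul_sum]
  exact Finset.sum_congr rfl fun j _ => by rw [add_tsub_cancel_left, pow_add]; ring

theorem stmt6 (α : ℝ) (hα : α ∈ Set.Ioo (0 : ℝ) 1) (n : ℕ) (hn : 1 ≤ n) (z : ℝ)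
    (hz : 0 < z) :
    ∑ k ∈ Finset.Icc 1 n, genFacCoeff n k α * z ^ k =
      ∑ i ∈ Finset.Icc 1 n, (-1 : ℝ) ^ i * risingFac (-(i : ℝ) * α) n 1 *
        Real.exp z * z ^ i * upperGamma ((n : ℝ) - i + 1) z /
          ((Nat.factorial i : ℝ) * (Nat.factorial (n - i) : ℝ)) := by
  have hl : ∀ k ∈ Finset.Icc 1 n, genFacCoeff n k α * z ^ k =
      ∑ i ∈ Finset.Icc 1 k, (-1 : ℝ) ^ i * risingFac (-(i : ℝ) * α) n 1 / (i.factorial : ℝ) *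
        (z ^ k / ((k - i).factorial : ℝ)) := by
    intro k _
    rw [genFacCoeff, Finset.mul_sum, Finset.sum_mul]
    refine Finset.sum_congr rfl fun i hi => ?_
    rw [Nat.cast_choose ℝ (Finset.mem_Icc.1 hi).2]
    have : (k.factorial : ℝ) ≠ 0 := by positivity
    field_simp
  rw [Finset.sum_congr rfl hl, Finset.sum_comm' (t' := Finset.Icc 1 n)
    (s' := fun i => Finset.Icc i n) (by intro k i; simp only [Finset.mem_Icc]; omega)]
  refine Finset.sum_congr rfl fun i hi => ?_
  rw [← Finset.mul_sum, ← exp_mul_upperGamma_sub_add_one (Finset.mem_Icc.1 hi).2 hz]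
  field_simp
end

section
/- Let α ∈ (0,1), let n ≥ 1 be an integer and let i ∈ {1,…,n}. Then (1/i!) · |[-iα]_{(n,1)} / [-α]_{(n,1)}| ≤ |Γ(-α)| · Γ(n-iα) / Γ(n-α), where Γ is the Gamma function (note n - iα ≥ n(1-α) > 0 and n - α > 0, and Γ(-α) is the Gamma function evaluated at the negative non-integer -α). -/
open Real
open scoped BigOperators

theorem Gamma_add_nat_eq_risingFac_mul {x : ℝ} {n : ℕ} (h : risingFac x n 1 ≠ 0) :
    Real.Gamma (x + n) = risingFac x n 1 * Real.Gamma x := by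
  induction n with
  | zero => simp [risingFac]
  | succ n ih =>
    have hs : risingFac x (n + 1) 1 = risingFac x n 1 * (x + n) := by
      simp [risingFac, Finset.prod_range_succ]
    rw [hs] at h ⊢
    have hx : x + n ≠ 0 := right_ne_zero_of_mul h
    have hcast : x + ((n + 1 : ℕ) : ℝ) = x + n + 1 := by push_cast; ring
    rw [hcast, Real.Gamma_add_one hx, ih (left_ne_zero_of_mul h)]
    ring

theorem Gamma_add_one_le_factorial {x : ℝ} {i : ℕ} (hx : 0 ≤ x) (hxi : x ≤ i) :
    Real.Gamma (x + 1) ≤ i.factorial := by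
  have h := Real.convexOn_Gamma.le_max_of_mem_Icc (x := 1) (y := (i : ℝ) + 1) (z := x + 1)
    (by simp) (by simp only [Set.mem_Ioi]; positivity) ⟨by linarith, by linarith⟩
  rw [Real.Gamma_one, Real.Gamma_nat_eq_factorial] at h
  exact h.trans (max_le (by exact_mod_cast i.factorial_pos) le_rfl)

theorem one_le_factorial_mul_abs_Gamma_neg {x : ℝ} {i : ℕ} (hx : 0 ≤ x) (hxi : x ≤ i)
    (h : Real.Gamma (-x) ≠ 0) : 1 ≤ (i.factorial : ℝ) * |Real.Gamma (-x)| := by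
  have hpos : 0 < Real.Gamma (x + 1) := Real.Gamma_pos_of_pos (by linarith)
  have hrefl := Real.Gamma_mul_Gamma_one_sub (-x)
  rw [show 1 - -x = x + 1 by ring] at hrefl
  have hsin : Real.sin (π * -x) ≠ 0 := by
    intro h0
    rw [h0, div_zero] at hrefl
    exact mul_ne_zero h hpos.ne' hrefl
  have habs := congrArg abs hrefl
  rw [abs_mul, abs_div, abs_of_pos hpos, abs_of_pos Real.pi_pos] at habs
  calc (1 : ℝ) ≤ π := by linarith [Real.pi_gt_three]
    _ ≤ π / |Real.sin (π * -x)| :=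
        le_div_self Real.pi_pos.le (abs_pos.mpr hsin) (Real.abs_sin_le_one _)
    _ = |Real.Gamma (-x)| * Real.Gamma (x + 1) := habs.symm
    _ ≤ |Real.Gamma (-x)| * i.factorial := by
        gcongr
        exact Gamma_add_one_le_factorial hx hxi
    _ = i.factorial * |Real.Gamma (-x)| := mul_comm _ _

theorem stmt8 (α : ℝ) (hα : α ∈ Set.Ioo (0 : ℝ) 1) (n : ℕ) (hn : 1 ≤ n)
    (i : ℕ) (hi : i ∈ Finset.Icc 1 n) :
    (1 / (Nat.factorial i : ℝ)) * |risingFac (-(i : ℝ) * α) n 1 / risingFac (-α) n 1| ≤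
      |Real.Gamma (-α)| * Real.Gamma ((n : ℝ) - i * α) / Real.Gamma ((n : ℝ) - α) := by
  obtain ⟨hα0, hα1⟩ := hα
  obtain ⟨hi1, hin⟩ := Finset.mem_Icc.mp hi
  have hn' : (1 : ℝ) ≤ n := by exact_mod_cast hn
  have hi' : (1 : ℝ) ≤ i := by exact_mod_cast hi1
  have hin' : (i : ℝ) ≤ n := by exact_mod_cast hin
  have hiα : (i : ℝ) * α < i := by nlinarith
  have hΓi : 0 < Real.Gamma ((n : ℝ) - i * α) := Real.Gamma_pos_of_pos (by linarith)
  have hΓ : 0 < Real.Gamma ((n : ℝ) - α) := Real.Gamma_pos_of_pos (by linarith)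
  have hden : risingFac (-α) n 1 ≠ 0 := by
    refine Finset.prod_ne_zero_iff.mpr fun k _ => ?_
    rcases Nat.eq_zero_or_pos k with rfl | hk
    · simpa using hα0.ne'
    · have : (1 : ℝ) ≤ k := by exact_mod_cast hk
      linarith
  have hGden := Gamma_add_nat_eq_risingFac_mul hden
  rw [show -α + (n : ℝ) = n - α by ring] at hGden
  by_cases hnum : risingFac (-(i : ℝ) * α) n 1 = 0
  · rw [hnum]
    simp only [zero_div, abs_zero, mul_zero]
    positivity
  have hGnum := Gamma_add_nat_eq_risingFac_mul hnum
  rw [show -(i : ℝ) * α + n = n - i * α by ring] at hGnum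
  have hΓneg : Real.Gamma (-(i * α)) ≠ 0 := by
    rw [← neg_mul]
    exact right_ne_zero_of_mul (hGnum ▸ hΓi.ne')
  have hkey := one_le_factorial_mul_abs_Gamma_neg (by positivity) hiα.le hΓneg
  rw [← neg_mul] at hkey
  have hΓα : Real.Gamma (-α) ≠ 0 := right_ne_zero_of_mul (hGden ▸ hΓ.ne')
  rw [← abs_of_pos hΓi, ← abs_of_pos hΓ, hGnum, hGden, abs_div, abs_mul, abs_mul]
  have hA := abs_pos.mpr hΓα
  have hD := abs_pos.mpr hden
  have hF : (0 : ℝ) < i.factorial := by exact_mod_cast i.factorial_pos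
  calc _ = |risingFac (-(i : ℝ) * α) n 1| / |risingFac (-α) n 1| * (1 / i.factorial) :=
        mul_comm _ _
    _ ≤ |risingFac (-(i : ℝ) * α) n 1| / |risingFac (-α) n 1| * |Real.Gamma (-(i : ℝ) * α)| := by
        gcongr
        rwa [div_le_iff₀' hF]
    _ = _ := by field_simp
end

section
/- For every integer n ≥ 2, the function x ↦ n^x Γ(n-x) is monotone increasing on the interval (0,n): for all real x, y with 0 < x ≤ y < n, one has n^x Γ(n-x) ≤ n^y Γ(n-y). Here Γ is the Gamma function. -/
open Real

theorem log_Gamma_sub_log_Gamma_le {t s : ℝ} (ht : 0 < t) (hts : t ≤ s) :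
    log (Gamma s) - log (Gamma t) ≤ (s - t) * log s := by
  rcases hts.eq_or_lt with rfl | hlt
  · simp
  have hs : 0 < s := ht.trans hlt
  have h := convexOn_log_Gamma.slope_mono_adjacent (Set.mem_Ioi.2 ht)
    (Set.mem_Ioi.2 (show 0 < s + 1 by linarith)) hlt (lt_add_one s)
  simp only [Function.comp_apply, Gamma_add_one hs.ne',
    log_mul hs.ne' (Gamma_pos_of_pos hs).ne', add_sub_cancel_right, add_sub_cancel_left,
    div_one] at h
  rwa [div_le_iff₀' (sub_pos.2 hlt)] at h

theorem stmt9 (n : ℕ) (hn : 2 ≤ n) (x y : ℝ) (hx : 0 < x) (hxy : x ≤ y) (hy : y < n) :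
    (n : ℝ) ^ x * Real.Gamma ((n : ℝ) - x) ≤ (n : ℝ) ^ y * Real.Gamma ((n : ℝ) - y) := by
  have hn0 : (0 : ℝ) < n := by positivity
  have hGx : 0 < Gamma ((n : ℝ) - x) := Gamma_pos_of_pos (by linarith)
  have hGy : 0 < Gamma ((n : ℝ) - y) := Gamma_pos_of_pos (by linarith)
  have h := log_Gamma_sub_log_Gamma_le (sub_pos.2 hy) (sub_le_sub_left hxy (n : ℝ))
  have hlog : log ((n : ℝ) - x) ≤ log n := log_le_log (by linarith) (by linarith)
  have hmul := mul_le_mul_of_nonneg_left hlog (sub_nonneg.2 hxy)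
  rw [← log_le_log_iff (by positivity) (by positivity), log_mul (by positivity) hGx.ne',
    log_mul (by positivity) hGy.ne', log_rpow hn0, log_rpow hn0]
  linarith
end

section
/- For every real z > 0, the logarithmic derivative of the Gamma function satisfies ψ(z) := Γ'(z)/Γ(z) ≤ log(z); equivalently, Γ'(z) ≤ Γ(z) · log(z), where Γ' denotes the derivative of the Gamma function. -/
open Real

theorem stmt10 (z : ℝ) (hz : 0 < z) :
    deriv Real.Gamma z / Real.Gamma z ≤ Real.log z ∧
    deriv Real.Gamma z ≤ Real.Gamma z * Real.log z := by
  have hΓ : 0 < Real.Gamma z := Real.Gamma_pos_of_pos hz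
  have hd : DifferentiableAt ℝ Real.Gamma z :=
    Real.differentiableAt_Gamma fun m => ((neg_nonpos.2 m.cast_nonneg).trans_lt hz).ne'
  have hlog : HasDerivAt (Real.log ∘ Real.Gamma) (deriv Real.Gamma z / Real.Gamma z) z :=
    hd.hasDerivAt.log hΓ.ne'
  have hψ : deriv Real.Gamma z / Real.Gamma z ≤ Real.log z := by
    have h := Real.convexOn_log_Gamma.deriv_le_slope (Set.mem_Ioi.2 hz)
      (Set.mem_Ioi.2 (add_pos hz one_pos)) (lt_add_one z) hlog.differentiableAt
    rw [hlog.deriv, slope_def_field, add_sub_cancel_left, div_one, Function.comp_apply,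
      Function.comp_apply, Real.Gamma_add_one hz.ne', Real.log_mul hz.ne' hΓ.ne',
      add_sub_cancel_right] at h
    exact h
  exact ⟨hψ, (div_le_iff₀' hΓ).1 hψ⟩
end
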